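/- arXiv:2511.10153 — 3 statements merged into one kernel-verified Lean document; each statement's English description precedes it below -/
import Mathlib

section
/- Let m ≥ 1 and let T = U(1)^m be the m-dimensional torus. Let Q be a compact, Hausdorff, second-countable topological space, and let λ assign to each point q ∈ Q a closed subgroup λ(q) ≤ T such that every q ∈ Q has an open neighborhood U with λ(q') ⊆ λ(q) for all q' ∈ U. Then the canonical model X(Q,λ) = (Q × T)/∼_λ is compact, Hausdorff, and second-countable. -/
/-- The equivalence relation `∼_λ` defining the canonical model:
`(q,t) ∼ (q',s)` iff `q = q'` and `t⁻¹ * s ∈ λ q`. -/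
def canonSetoid (Q : Type*) {T : Type*} [Group T] (lam : Q → Subgroup T) :
    Setoid (Q × T) where
  r p p' := p.1 = p'.1 ∧ p.2⁻¹ * p'.2 ∈ lam p.1
  iseqv := by
    constructor
    · intro p; exact ⟨rfl, by simpa using (lam p.1).one_mem⟩
    · rintro ⟨q, t⟩ ⟨q', t'⟩ ⟨h1, h2⟩
      dsimp at *
      subst h1
      refine ⟨rfl, ?_⟩
      have := (lam q).inv_mem h2
      simpa using this
    · rintro ⟨q, t⟩ ⟨q', t'⟩ ⟨q'', t''⟩ ⟨h1, h2⟩ ⟨h1', h2'⟩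
      dsimp at *
      subst h1; subst h1'
      refine ⟨rfl, ?_⟩
      have := (lam q).mul_mem h2 h2'
      simpa [mul_assoc] using this

/-- The canonical model `X(Q, λ) = (Q × T)/∼_λ`, with the quotient topology. -/
def CanonModel (Q : Type*) [TopologicalSpace Q] {T : Type*} [Group T] [TopologicalSpace T]
    (lam : Q → Subgroup T) : Type _ :=
  Quotient (canonSetoid Q lam)

instance (Q : Type*) [TopologicalSpace Q] {T : Type*} [Group T] [TopologicalSpace T]
    (lam : Q → Subgroup T) : TopologicalSpace (CanonModel Q lam) :=
  instTopologicalSpaceQuotient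

open Set Topology Filter in
theorem closedMap_compact_t2_secondCountable_aux {X Y : Type*} [TopologicalSpace X]
    [TopologicalSpace Y] [CompactSpace X] [T2Space X] [SecondCountableTopology X]
    (f : X → Y) (hf : Continuous f) (hs : Function.Surjective f) (hc : IsClosedMap f) :
    T2Space Y ∧ SecondCountableTopology Y := by
  have hk : ∀ {u : Set X}, IsOpen u → IsOpen (kernImage f u) := isClosedMap_iff_kernImage.1 hc
  have hfib : ∀ y, IsClosed (f ⁻¹' {y}) := by
    intro y
    obtain ⟨x, rfl⟩ := hs y
    have := hc {x} isClosed_singleton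
    rw [image_singleton] at this
    exact this.preimage hf
  refine ⟨⟨?_⟩, ?_⟩
  · intro y z hyz
    have hd : Disjoint (f ⁻¹' {y}) (f ⁻¹' {z}) :=
      Disjoint.preimage f (by simpa using hyz)
    obtain ⟨u, v, hu, hv, hyu, hzv, huv⟩ := normal_separation (hfib y) (hfib z) hd
    refine ⟨kernImage f u, kernImage f v, hk hu, hk hv, ?_, ?_, ?_⟩
    · intro x hx; exact hyu hx
    · intro x hx; exact hzv hx
    · rw [Set.disjoint_left]
      intro w hw hw'
      obtain ⟨x, rfl⟩ := hs w
      exact Set.disjoint_left.1 huv (hw rfl) (hw' rfl)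
  · let B := TopologicalSpace.countableBasis X
    have hB : TopologicalSpace.IsTopologicalBasis B := TopologicalSpace.isBasis_countableBasis X
    have hBc : B.Countable := TopologicalSpace.countable_countableBasis X
    have hFc : {F : Set (Set X) | F.Finite ∧ F ⊆ B}.Countable := countable_setOf_finite_subset hBc
    have hb : TopologicalSpace.IsTopologicalBasis
        ((fun F : Set (Set X) => kernImage f (⋃₀ F)) '' {F : Set (Set X) | F.Finite ∧ F ⊆ B}) := by
      refine TopologicalSpace.isTopologicalBasis_of_isOpen_of_nhds ?_ ?_
      · rintro _ ⟨F, ⟨-, hF⟩, rfl⟩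
        exact hk (isOpen_sUnion fun t ht => hB.isOpen (hF ht))
      · intro y V hy hV
        have hcomp : IsCompact (f ⁻¹' {y}) := (hfib y).isCompact
        have hsub : f ⁻¹' {y} ⊆ ⋃₀ {b ∈ B | b ⊆ f ⁻¹' V} := by
          intro x hx
          have hxV : x ∈ f ⁻¹' V := by
            have : f x = y := hx
            simpa [this] using hy
          obtain ⟨b, hbB, hxb, hbV⟩ := hB.exists_subset_of_mem_open hxV (hV.preimage hf)
          exact ⟨b, ⟨hbB, hbV⟩, hxb⟩
        rw [sUnion_eq_biUnion] at hsub
        obtain ⟨F, hFs, hFf, hFc⟩ := hcomp.elim_finite_subcover_image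
          (fun b hb => hB.isOpen hb.1) hsub
        refine ⟨_, ⟨F, ⟨hFf, fun b hb => (hFs hb).1⟩, rfl⟩, ?_, ?_⟩
        · intro x hx
          rw [sUnion_eq_biUnion]
          exact hFc hx
        · intro z hz
          obtain ⟨x, rfl⟩ := hs z
          obtain ⟨b, hbF, hxb⟩ := hz rfl
          exact (hFs hbF).2 hxb
    exact hb.secondCountableTopology (hFc.image _)

open Set Topology Filter in
theorem canon_rel_closed_aux {Q T : Type*} [TopologicalSpace Q] [T2Space Q] [Group T]
    [TopologicalSpace T] [IsTopologicalGroup T] (lam : Q → Subgroup T)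
    (hclosed : ∀ q : Q, IsClosed ((lam q : Set T)))
    (hsmall : ∀ q : Q, ∃ U : Set Q, IsOpen U ∧ q ∈ U ∧ ∀ q' ∈ U, lam q' ≤ lam q) :
    IsClosed {p : (Q × T) × (Q × T) | p.1.1 = p.2.1 ∧ p.1.2⁻¹ * p.2.2 ∈ lam p.1.1} := by
  rw [← isOpen_compl_iff, isOpen_iff_mem_nhds]
  rintro ⟨⟨q, t⟩, ⟨q', s⟩⟩ h
  by_cases hq : q = q'
  · subst hq
    obtain ⟨U, hU, hqU, hUs⟩ := hsmall q
    have hts : t⁻¹ * s ∈ (lam q : Set T)ᶜ := fun h' => h ⟨rfl, h'⟩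
    have h1 : {p : (Q × T) × (Q × T) | p.1.1 ∈ U} ∈ 𝓝 ((q, t), (q, s)) :=
      (hU.preimage (by fun_prop : Continuous fun p : (Q × T) × (Q × T) => p.1.1)).mem_nhds hqU
    have h2 : (fun p : (Q × T) × (Q × T) => p.1.2⁻¹ * p.2.2) ⁻¹' (lam q : Set T)ᶜ
        ∈ 𝓝 ((q, t), (q, s)) :=
      ((hclosed q).isOpen_compl.preimage (by fun_prop)).mem_nhds hts
    filter_upwards [h1, h2] with p hp1 hp2 hp
    exact hp2 (hUs _ hp1 hp.2)
  · have h1 : {p : (Q × T) × (Q × T) | p.1.1 ≠ p.2.1} ∈ 𝓝 ((q, t), (q', s)) :=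
      (isOpen_ne_fun (by fun_prop) (by fun_prop)).mem_nhds hq
    filter_upwards [h1] with p hp1 hp
    exact hp1 hp.1

/-- If `Q` is compact, Hausdorff and second countable, each `λ(q)` is a
closed subgroup of the torus `T = U(1)^m`, and every point of `Q` has an open neighborhood
`U` with `λ(q') ⊆ λ(q)` for all `q' ∈ U`, then the canonical model `X(Q,λ)` is compact,
Hausdorff and second countable. -/
theorem canonModel_compact_t2_secondCountable (m : ℕ) (hm : 1 ≤ m)
    (Q : Type*) [TopologicalSpace Q] [CompactSpace Q] [T2Space Q] [SecondCountableTopology Q]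
    (lam : Q → Subgroup (Fin m → Circle))
    (hclosed : ∀ q : Q, IsClosed ((lam q : Set (Fin m → Circle))))
    (hsmall : ∀ q : Q, ∃ U : Set Q, IsOpen U ∧ q ∈ U ∧ ∀ q' ∈ U, lam q' ≤ lam q) :
    CompactSpace (CanonModel Q lam) ∧ T2Space (CanonModel Q lam) ∧
      SecondCountableTopology (CanonModel Q lam) := by
  have hR := canon_rel_closed_aux lam hclosed hsmall
  let f : Q × (Fin m → Circle) → CanonModel Q lam := Quotient.mk (canonSetoid Q lam)
  have hf : Continuous f := continuous_quot_mk
  have hs : Function.Surjective f := Quotient.mk_surjective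
  have hqm : Topology.IsQuotientMap f := isQuotientMap_quot_mk
  have hc : IsClosedMap f := by
    intro C hC
    rw [← hqm.isClosed_preimage]
    have := isClosedMap_snd_of_compactSpace _ (hR.inter (hC.preimage continuous_fst))
    convert this using 1
    ext p
    constructor
    · rintro ⟨x, hx, hxp⟩
      have h : (canonSetoid Q lam).r x p := Quotient.exact hxp
      exact ⟨(x, p), ⟨h, hx⟩, rfl⟩
    · rintro ⟨⟨x, p'⟩, ⟨h, hx⟩, rfl⟩
      have h' : (canonSetoid Q lam).r x p' := h
      exact ⟨x, hx, Quotient.sound h'⟩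
  refine ⟨?_, closedMap_compact_t2_secondCountable_aux f hf hs hc⟩
  exact hs.compactSpace hf
end

section
/- Let V ⊂ ℝⁿ be a finite set, let P = conv(V) be its convex hull, and let v be an extreme point of P. Let g : ℝⁿ → ℝ be a linear functional and d ∈ ℝ such that g(v) > d and g(w) < d for every extreme point w of P with w ≠ v (i.e. the hyperplane {g = d} strictly separates the vertex v from all other vertices of P). Then conv({v} ∪ (P ∩ {x : g(x) = d})) = P ∩ {x : g(x) ≥ d}. -/
/-- Let `P = conv V` be the convex hull of a finite set `V ⊆ ℝⁿ`, let
`v` be an extreme point (vertex) of `P`, and let a hyperplane `{g = d}` strictly separate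
`v` from all other vertices of `P` (`g v > d` and `g w < d` for every extreme point
`w ≠ v`).  Then `conv({v} ∪ (P ∩ {g = d})) = P ∩ {g ≥ d}`. -/
theorem vertexFigure_cone (n : ℕ) (V : Set (Fin n → ℝ)) (hV : V.Finite)
    (v : Fin n → ℝ) (hv : v ∈ Set.extremePoints ℝ (convexHull ℝ V))
    (g : (Fin n → ℝ) →ₗ[ℝ] ℝ) (d : ℝ)
    (hgv : d < g v)
    (hsep : ∀ w ∈ Set.extremePoints ℝ (convexHull ℝ V), w ≠ v → g w < d) :
    convexHull ℝ ({v} ∪ (convexHull ℝ V ∩ {x | g x = d})) =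
      convexHull ℝ V ∩ {x | d ≤ g x} := by
  set P := convexHull ℝ V with hP
  have hPc : Convex ℝ P := convex_convexHull ℝ V
  have hext : P.extremePoints ℝ ⊆ V := extremePoints_convexHull_subset
  have hfin : (P.extremePoints ℝ).Finite := hV.subset hext
  have hKM : convexHull ℝ (P.extremePoints ℝ) = P := by
    have h1 := closure_convexHull_extremePoints (hV.isCompact_convexHull (𝕜 := ℝ)) hPc
    rwa [(hfin.isClosed_convexHull (𝕜 := ℝ)).closure_eq] at h1
  have hvP : v ∈ P := hv.1
  apply Set.Subset.antisymm
  · apply convexHull_min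
    · rintro x (hx | ⟨hx, hx'⟩)
      · rw [Set.mem_singleton_iff] at hx
        subst hx
        exact ⟨hvP, hgv.le⟩
      · exact ⟨hx, le_of_eq (Eq.symm hx')⟩
    · exact hPc.inter (convex_halfSpace_ge g.isLinear d)
  · rintro x ⟨hx, hxd⟩
    have hxd' : d ≤ g x := hxd
    have hvH : v ∈ convexHull ℝ ({v} ∪ (P ∩ {x | g x = d})) :=
      subset_convexHull ℝ _ (Or.inl rfl)
    have hins : P.extremePoints ℝ = insert v (P.extremePoints ℝ \ {v}) := by
      rw [Set.insert_diff_singleton, Set.insert_eq_of_mem hv]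
    rcases (P.extremePoints ℝ \ {v}).eq_empty_or_nonempty with he | hne
    · rw [← hKM, hins, he] at hx
      simp at hx
      rw [hx]; exact hvH
    · have hx2 := hx
      rw [← hKM, hins, convexHull_insert hne, convexJoin_singleton_left] at hx2
      simp only [Set.mem_iUnion] at hx2
      obtain ⟨y, hy, a, b, ha, hb, hab, hxy⟩ := hx2
      have hyP : y ∈ P := by
        rw [← hKM]; exact convexHull_mono Set.diff_subset hy
      have hyd : g y < d := by
        have : convexHull ℝ (P.extremePoints ℝ \ {v}) ⊆ {x | g x < d} :=
          convexHull_min (fun w hw => hsep w hw.1 hw.2) (convex_halfSpace_lt g.isLinear d)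
        exact this hy
      have hgx : g x = a * g v + b * g y := by rw [← hxy]; simp
      have hpos : 0 < g v - g y := by linarith
      have hpos2 : 0 < g v - d := by linarith
      have ha' : a = 1 - b := by linarith
      have hzH : ((d - g y) / (g v - g y)) • v + ((g v - d) / (g v - g y)) • y ∈
          convexHull ℝ ({v} ∪ (P ∩ {x | g x = d})) := by
        apply subset_convexHull
        right
        constructor
        · apply hPc hvP hyP
          · exact div_nonneg (by linarith) hpos.le
          · exact div_nonneg hpos2.le hpos.le
          · field_simp; ring
        · simp only [Set.mem_setOf_eq, map_add, map_smul, smul_eq_mul]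
          field_simp; ring
      have ht : b * (g v - g y) / (g v - d) ≤ 1 := by
        rw [div_le_one hpos2]
        rw [ha'] at hgx
        linarith
      have key := convex_convexHull ℝ ({v} ∪ (P ∩ {x | g x = d})) hvH hzH
        (sub_nonneg.2 ht) (div_nonneg (mul_nonneg hb hpos.le) hpos2.le) (by ring)
      convert key using 1
      rw [← hxy, ha']
      ext i
      simp only [Pi.add_apply, Pi.smul_apply, smul_eq_mul]
      field_simp
      ring
end

section
/- Let A be a finite index set and, for each j ∈ A, let f_j : ℝⁿ → ℝ be a linear functional and c_j ∈ ℝ; assume that P := ⋂_{j∈A} {x : f_j(x) ≤ c_j} is nonempty and compact. Let p ∈ P, let N ⊆ ℝⁿ be an affine subspace containing p, let g : ℝⁿ → ℝ be a linear functional, and let d ∈ ℝ with g(p) > d. Assume that for every j ∈ A with f_j(p) < c_j (every constraint inactive at p), the set P ∩ {x : g(x) ≥ d} ∩ N ∩ {x : f_j(x) = c_j} is empty. Then conv({p} ∪ (P ∩ {x : g(x) = d} ∩ N)) = P ∩ {x : g(x) ≥ d} ∩ N. -/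
/-- Let `P = ⋂_{j ∈ A} {f_j ≤ c_j}` be a nonempty compact intersection
of finitely many closed half-spaces in `ℝⁿ`, let `p ∈ P`, let `N` be an affine subspace
containing `p`, and let a hyperplane `{g = d}` satisfy `g p > d`.  If, for every
constraint `j` inactive at `p` (i.e. `f_j p < c_j`), the set
`P ∩ {g ≥ d} ∩ N ∩ {f_j = c_j}` is empty, then
`conv({p} ∪ (P ∩ {g = d} ∩ N)) = P ∩ {g ≥ d} ∩ N`. -/
theorem polytope_cone_over_link (n : ℕ) (ι : Type*) [Fintype ι]
    (f : ι → ((Fin n → ℝ) →ₗ[ℝ] ℝ)) (c : ι → ℝ)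
    (hne : (⋂ j : ι, {x : Fin n → ℝ | f j x ≤ c j}).Nonempty)
    (hcpt : IsCompact (⋂ j : ι, {x : Fin n → ℝ | f j x ≤ c j}))
    (p : Fin n → ℝ) (hp : p ∈ ⋂ j : ι, {x : Fin n → ℝ | f j x ≤ c j})
    (N : AffineSubspace ℝ (Fin n → ℝ)) (hpN : p ∈ N)
    (g : (Fin n → ℝ) →ₗ[ℝ] ℝ) (d : ℝ) (hgp : d < g p)
    (hclose : ∀ j : ι, f j p < c j →
      (⋂ j' : ι, {x : Fin n → ℝ | f j' x ≤ c j'}) ∩ {x | d ≤ g x} ∩ (N : Set (Fin n → ℝ)) ∩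
        {x | f j x = c j} = ∅) :
    convexHull ℝ ({p} ∪
        ((⋂ j : ι, {x : Fin n → ℝ | f j x ≤ c j}) ∩ {x | g x = d} ∩ (N : Set (Fin n → ℝ)))) =
      (⋂ j : ι, {x : Fin n → ℝ | f j x ≤ c j}) ∩ {x | d ≤ g x} ∩ (N : Set (Fin n → ℝ)) := by
  have hfc : ∀ j, Continuous (f j) := fun j => (f j).continuous_of_finiteDimensional
  have hgc : Continuous g := g.continuous_of_finiteDimensional
  have hp' : ∀ j, f j p ≤ c j := by simpa using hp
  apply Set.Subset.antisymm
  · apply convexHull_min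
    · rintro x (rfl | ⟨⟨hx, hgx⟩, hxN⟩)
      · exact ⟨⟨hp, hgp.le⟩, hpN⟩
      · exact ⟨⟨hx, (show g x = d from hgx).ge⟩, hxN⟩
    · refine Convex.inter (Convex.inter ?_ ?_) N.convex
      · exact convex_iInter fun j => convex_halfSpace_le (f j).isLinear (c j)
      · exact convex_halfSpace_ge g.isLinear d
  · rintro x ⟨⟨hx, hgx⟩, hxN⟩
    by_cases hxp : x = p
    · subst hxp
      exact subset_convexHull ℝ _ (Or.inl rfl)
    have hpos : 0 < ‖x - p‖ := norm_pos_iff.2 (sub_ne_zero.2 hxp)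
    have hx' : ∀ j, f j x ≤ c j := by simpa using hx
    have hgx' : d ≤ g x := hgx
    let T : Set ℝ := {t | 1 ≤ t ∧ (∀ j, f j (p + t • (x - p)) ≤ c j) ∧ d ≤ g (p + t • (x - p))}
    have hTclosed : IsClosed T := by
      have hT : T = Set.Ici 1 ∩ ((⋂ j, {t : ℝ | f j (p + t • (x - p)) ≤ c j}) ∩
          {t : ℝ | d ≤ g (p + t • (x - p))}) := by
        ext t
        simp [T]
      rw [hT]
      refine isClosed_Ici.inter (IsClosed.inter (isClosed_iInter fun j => ?_) ?_)
      · exact isClosed_le ((hfc j).comp (by fun_prop)) continuous_const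
      · exact isClosed_le continuous_const (hgc.comp (by fun_prop))
    obtain ⟨R, hR⟩ := hcpt.isBounded.exists_norm_le
    have hTsub : T ⊆ Set.Icc 1 ((R + ‖p‖) / ‖x - p‖) := by
      rintro t ⟨ht1, htf, -⟩
      refine ⟨ht1, ?_⟩
      rw [le_div_iff₀ hpos]
      have h1 := hR (p + t • (x - p)) (by simpa using htf)
      have h2 : ‖t • (x - p)‖ = t * ‖x - p‖ := by
        rw [norm_smul, Real.norm_of_nonneg (by linarith)]
      have h3 : ‖t • (x - p)‖ ≤ ‖p + t • (x - p)‖ + ‖p‖ := by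
        simpa using norm_sub_le (p + t • (x - p)) p
      linarith
    have hTc : IsCompact T := isCompact_Icc.of_isClosed_subset hTclosed hTsub
    have h1T : (1 : ℝ) ∈ T := ⟨le_rfl, by simpa using hx', by simpa using hgx'⟩
    obtain ⟨t, ⟨ht1, htf, htg⟩, hmax⟩ := hTc.exists_isGreatest ⟨1, h1T⟩
    have hyN : p + t • (x - p) ∈ N := by
      have := AffineMap.lineMap_mem (Q := N) t hpN hxN
      rw [AffineMap.lineMap_apply_module'] at this
      rwa [add_comm]
    have hgy : g (p + t • (x - p)) = d := by
      by_contra hne'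
      have hlt : d < g (p + t • (x - p)) := lt_of_le_of_ne htg (Ne.symm hne')
      have e1 : ∀ᶠ s in nhdsWithin t (Set.Ioi t), d < g (p + s • (x - p)) := by
        have hc : Continuous fun s : ℝ => g (p + s • (x - p)) := hgc.comp (by fun_prop)
        exact nhdsWithin_le_nhds (hc.continuousAt.eventually (lt_mem_nhds hlt))
      have e2 : ∀ᶠ s in nhdsWithin t (Set.Ioi t), ∀ j, f j (p + s • (x - p)) ≤ c j := by
        rw [Filter.eventually_all]
        intro j
        rcases (hp' j).lt_or_eq with hj | hj
        · have hlt' : f j (p + t • (x - p)) < c j := by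
            refine lt_of_le_of_ne (htf j) fun h => ?_
            have : p + t • (x - p) ∈ (∅ : Set (Fin n → ℝ)) := by
              rw [← hclose j hj]
              exact ⟨⟨⟨by simpa using htf, htg⟩, hyN⟩, h⟩
            exact this
          have hc : Continuous fun s : ℝ => f j (p + s • (x - p)) := (hfc j).comp (by fun_prop)
          exact nhdsWithin_le_nhds
            ((hc.continuousAt.eventually (gt_mem_nhds hlt')).mono fun s hs => le_of_lt hs)
        · filter_upwards [self_mem_nhdsWithin] with s hs
          have hs' : t < s := hs
          have := hx' j
          simp only [map_add, map_smul, map_sub, smul_eq_mul]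
          nlinarith
      obtain ⟨s, ⟨hs1, hs2⟩, hs3⟩ := ((e1.and e2).and self_mem_nhdsWithin).exists
      have hs3' : t < s := hs3
      exact absurd (hmax ⟨by linarith, hs2, hs1.le⟩) (not_le.2 hs3')
    have hxe : x = (1 - t⁻¹) • p + t⁻¹ • (p + t • (x - p)) := by
      rw [smul_add, smul_smul, inv_mul_cancel₀ (by linarith)]
      module
    rw [hxe]
    have ht0 : 0 < t := by linarith
    refine convex_convexHull ℝ _ (subset_convexHull ℝ _ ?_) (subset_convexHull ℝ _ ?_)
      (sub_nonneg.2 (inv_le_one_of_one_le₀ ht1)) (inv_nonneg.2 ht0.le) (by ring)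
    · exact Or.inl rfl
    · exact Or.inr ⟨⟨by simpa using htf, hgy⟩, hyN⟩
end
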